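/- Let G = G^m_{(k_1,m_1)(k_2,m_2)⋯(k_r,m_r)} be a level-wise regular block graph. Then G is a lower bound block graph and rn(G) = [(m−1) + m·Σ_{i=1}^{r} (Π_{j=1}^{i} k_j m_j)]·(2r+1) − 2m·Σ_{i=1}^{r} i·(Π_{j=1}^{i} k_j m_j) + ε(G), where ε(G) = 1 if m = 1 and ε(G) = 0 if m ≥ 3. -/

import Mathlib

open scoped Classical

namespace RadioLabeling

variable {V : Type*} [Fintype V]

/-- The diameter of a graph: maximum distance between two vertices. -/
noncomputable def diam (G : SimpleGraph V) : ℕ :=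
  Finset.univ.sup fun p : V × V => G.dist p.1 p.2

/-- A vertex set `S` induces a 2-connected subgraph: the induced subgraph is connected
and contains no cut-vertex. -/
def TwoConn (G : SimpleGraph V) (S : Set V) : Prop :=
  (G.induce S).Connected ∧ ∀ v ∈ S, (S \ {v} : Set V) = ∅ ∨ (G.induce (S \ {v})).Connected

/-- A block: a maximal 2-connected induced subgraph. -/
def IsBlock (G : SimpleGraph V) (S : Set V) : Prop :=
  TwoConn G S ∧ ∀ T : Set V, S ⊆ T → TwoConn G T → T = S

/-- A block graph: a connected graph each of whose blocks is a clique. -/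
def IsBlockGraph (G : SimpleGraph V) : Prop :=
  G.Connected ∧ ∀ S : Set V, IsBlock G S → G.IsClique S

/-- The weight of `G` at `v`: the sum of distances from `v` to all vertices. -/
noncomputable def wt (G : SimpleGraph V) (v : V) : ℕ := ∑ u : V, G.dist u v

/-- The set of weight centers: vertices minimizing the weight. -/
def weightCenters (G : SimpleGraph V) : Set V := {v | ∀ u : V, wt G v ≤ wt G u}

/-- `nCloser G v u` = number of vertices strictly closer to `v` than to `u`. -/
noncomputable def nCloser (G : SimpleGraph V) (v u : V) : ℕ :=
  (Finset.univ.filter fun z => G.dist v z < G.dist u z).card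

/-- A central vertex: either the unique weight center, or (when there are at least two
weight centers) a vertex of the central block, i.e. of a block containing all weight centers. -/
def IsCentral (G : SimpleGraph V) (w : V) : Prop :=
  weightCenters G = {w} ∨
    (2 ≤ (weightCenters G).ncard ∧
      ∃ S : Set V, IsBlock G S ∧ weightCenters G ⊆ S ∧ w ∈ S)

/-- The level of a vertex: its distance to a nearest central vertex. -/
noncomputable def level (G : SimpleGraph V) (v : V) : ℕ :=
  sInf {n | ∃ w, IsCentral G w ∧ G.dist v w = n}

/-- The total level of `G`. -/
noncomputable def totalLevel (G : SimpleGraph V) : ℕ := ∑ v : V, level G v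

/-- `eps G = 1` if `G` has a unique weight center, `0` otherwise. -/
noncomputable def eps (G : SimpleGraph V) : ℕ :=
  if (weightCenters G).ncard = 1 then 1 else 0

/-- A radio labeling: `|f u - f v| ≥ diam G + 1 - dist u v` for all distinct `u`, `v`. -/
def IsRadioLabeling (G : SimpleGraph V) (f : V → ℕ) : Prop :=
  ∀ u v : V, u ≠ v → diam G + 1 ≤ G.dist u v + max (f u - f v) (f v - f u)

/-- The span of a labeling: the maximum difference of two labels. -/
noncomputable def span (f : V → ℕ) : ℕ :=
  Finset.univ.sup fun p : V × V => f p.1 - f p.2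

/-- The radio number: minimum span of a radio labeling. -/
noncomputable def rn (G : SimpleGraph V) : ℕ :=
  sInf {s | ∃ f : V → ℕ, IsRadioLabeling G f ∧ span f = s}

/-- `G` achieves the lower bound `(p-1)(d(G)+ε(G)) - 2L(G) + ε(G)` for the radio number. -/
def lbEq (G : SimpleGraph V) : Prop :=
  (rn G : ℤ) =
    ((Fintype.card V : ℤ) - 1) * ((diam G : ℤ) + (eps G : ℤ)) -
      2 * (totalLevel G : ℤ) + (eps G : ℤ)

/-- A lower bound block graph: a block graph whose radio number equals the lower bound. -/
def IsLowerBoundBlockGraph (G : SimpleGraph V) : Prop := IsBlockGraph G ∧ lbEq G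

/-- `x` lies on a `(u,v)`-geodesic. -/
def OnGeodesic (G : SimpleGraph V) (x u v : V) : Prop :=
  G.dist u v = G.dist u x + G.dist x v

/-- `x` is an ancestor of `v` (and `v` a descendent of `x`): `x` lies on the geodesic
from some central vertex to `v`. -/
def IsAncestor (G : SimpleGraph V) (x v : V) : Prop :=
  ∃ w : V, IsCentral G w ∧ OnGeodesic G x w v

/-- `phi G u v`: the maximum level of a common ancestor of `u` and `v`. -/
noncomputable def phi (G : SimpleGraph V) (u v : V) : ℕ :=
  sSup {n | ∃ x, IsAncestor G x u ∧ IsAncestor G x v ∧ level G x = n}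

/-- `delta G u v = 1` iff the `(u,v)`-geodesic contains two central vertices. -/
noncomputable def delta (G : SimpleGraph V) (u v : V) : ℕ :=
  if ∃ x y : V, x ≠ y ∧ IsCentral G x ∧ IsCentral G y ∧
      OnGeodesic G x u v ∧ OnGeodesic G y u v
    then 1 else 0

/-- `rho G u v = 0` iff the `(u,v)`-geodesic contains a central vertex or a common
ancestor of `u` and `v`. -/
noncomputable def rho (G : SimpleGraph V) (u v : V) : ℕ :=
  if ∃ x : V, OnGeodesic G x u v ∧
      (IsCentral G x ∨ (IsAncestor G x u ∧ IsAncestor G x v))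
    then 0 else 1

/-- The central block: a block containing at least two weight centers, all of them. -/
def IsCentralBlock (G : SimpleGraph V) (D : Set V) : Prop :=
  IsBlock G D ∧ 2 ≤ (weightCenters G).ncard ∧ weightCenters G ⊆ D

/-- `v` belongs to the branch of `G` determined by the non-central block `D` adjacent to the
central vertex `w`: `v` is a vertex of `D` other than `w`, or a descendent of such a vertex. -/
def InBranch (G : SimpleGraph V) (w : V) (D : Set V) (v : V) : Prop :=
  IsCentral G w ∧ IsBlock G D ∧ w ∈ D ∧ ¬ IsCentralBlock G D ∧
    ∃ u ∈ D, u ≠ w ∧ IsAncestor G u v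

/-- Two vertices are in different branches: branches induced by two different blocks
adjacent to the same central vertex. -/
def DifferentBranches (G : SimpleGraph V) (u v : V) : Prop :=
  ∃ w D₁ D₂, D₁ ≠ D₂ ∧ InBranch G w D₁ u ∧ InBranch G w D₂ v

/-- Two vertices are in opposite branches: branches induced by blocks adjacent to two
different central vertices. -/
def OppositeBranches (G : SimpleGraph V) (u v : V) : Prop :=
  ∃ w₁ w₂ D₁ D₂, w₁ ≠ w₂ ∧ InBranch G w₁ D₁ u ∧ InBranch G w₂ D₂ v

/-- Two vertices lie in the same branch. -/
def SameBranch (G : SimpleGraph V) (u v : V) : Prop :=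
  ∃ w D, InBranch G w D u ∧ InBranch G w D v


/-- Vertices of the level-wise regular block graph `G^m_{(k_1,m_1)⋯(k_r,m_r)}`:
a root-clique index `t < m` together with, for each step `i < r`, either a child index
`< c i` (where `c i` is the number of children of each end vertex produced at step `i+1`)
or the sentinel value `c i`; the non-sentinel positions form an initial segment `[0, l)`,
`l` being the level of the vertex. -/
abbrev LWVert (m r : ℕ) (c : ℕ → ℕ) : Type _ :=
  Fin m × {f : (i : Fin r) → Fin (c (i : ℕ) + 1) //
    ∃ l ≤ r, ∀ i : Fin r, ((i : ℕ) < l ↔ (f i : ℕ) < c (i : ℕ))}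

/-- The level of a vertex of the level-wise regular block graph: the number of
non-sentinel positions. -/
noncomputable def lwLevel {m r : ℕ} {c : ℕ → ℕ} (v : LWVert m r c) : ℕ :=
  (Finset.univ.filter fun i : Fin r => ((v.2.1 i : ℕ) < c (i : ℕ))).card

/-- Base adjacency relation of the level-wise regular block graph: the `m` roots form a
clique `K_m`; every vertex is adjacent to each of its children; and two distinct children
of the same vertex are adjacent iff they got identified into the same clique `K_{m_i+1}`,
i.e. their last indices are congruent mod `k i`. -/
def lwRel (m r : ℕ) (k c : ℕ → ℕ) : LWVert m r c → LWVert m r c → Prop := fun u v =>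
  (lwLevel u = 0 ∧ lwLevel v = 0 ∧ u.1 ≠ v.1) ∨
  (u.1 = v.1 ∧ lwLevel v = lwLevel u + 1 ∧
    ∀ i : Fin r, (i : ℕ) < lwLevel u → v.2.1 i = u.2.1 i) ∨
  (u.1 = v.1 ∧ lwLevel u = lwLevel v ∧
    ∃ i : Fin r, (i : ℕ) + 1 = lwLevel u ∧
      (∀ j : Fin r, (j : ℕ) < (i : ℕ) → u.2.1 j = v.2.1 j) ∧
      u.2.1 i ≠ v.2.1 i ∧
      (u.2.1 i : ℕ) % k ((i : ℕ) + 1) = (v.2.1 i : ℕ) % k ((i : ℕ) + 1))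

/-- The level-wise regular block graph `G^m_{(k_1,m_1)(k_2,m_2)⋯(k_r,m_r)}`,
where `k i` and `q i` (for `1 ≤ i ≤ r`) are the parameters `k_i` and `m_i`:
each end vertex produced at step `i-1` gets `k i` cliques `K_{q i + 1}` attached,
hence `k i * q i` children. -/
def levelwiseRegularBlockGraph (m r : ℕ) (k q : ℕ → ℕ) :
    SimpleGraph (LWVert m r (fun i => k (i + 1) * q (i + 1))) :=
  SimpleGraph.fromRel (lwRel m r k (fun i => k (i + 1) * q (i + 1)))

/-! ### Coordinates of vertices -/

section Vertices

variable {m r : ℕ} {c : ℕ → ℕ}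

/-- The `i`-th child index of a vertex, with value `0` beyond the depth `r`. -/
def idx (v : LWVert m r c) (i : ℕ) : ℕ := if h : i < r then v.2.1 ⟨i, h⟩ else 0

lemma lt_lwLevel_iff (v : LWVert m r c) (i : Fin r) :
    (i : ℕ) < lwLevel v ↔ (v.2.1 i : ℕ) < c i := by
  obtain ⟨l, hl, h⟩ := v.2.2
  have : lwLevel v = l := by
    simp only [lwLevel, ← h, Fin.card_filter_val_lt]
    omega
  rw [this, h]

lemma lwLevel_le (v : LWVert m r c) : lwLevel v ≤ r := by
  simpa [lwLevel] using Finset.card_filter_le (Finset.univ : Finset (Fin r)) _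

lemma idx_lt {v : LWVert m r c} {i : ℕ} (hi : i < lwLevel v) : idx v i < c i := by
  have hr := hi.trans_le (lwLevel_le v)
  simpa [idx, hr] using (lt_lwLevel_iff v ⟨i, hr⟩).1 hi

lemma lwVert_ext {u v : LWVert m r c} (h1 : u.1 = v.1) (hl : lwLevel u = lwLevel v)
    (h : ∀ i < lwLevel u, idx u i = idx v i) : u = v := by
  refine Prod.ext h1 (Subtype.ext (funext fun i => Fin.ext ?_))
  by_cases hi : (i : ℕ) < lwLevel u
  · simpa [idx] using h i hi
  · have hu := (lt_lwLevel_iff u i).not.1 hi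
    have hv := (lt_lwLevel_iff v i).not.1 (hl ▸ hi)
    have := (u.2.1 i).isLt
    have := (v.2.1 i).isLt
    omega

/-- The vertex of level `l` above the root `t` with child indices `g`. -/
def lwMk (t : Fin m) (l : ℕ) (hl : l ≤ r) (g : ℕ → ℕ) (hg : ∀ i < l, g i < c i) :
    LWVert m r c :=
  (t, ⟨fun i => if h : (i : ℕ) < l then ⟨g i, (hg i h).trans (Nat.lt_succ_self _)⟩
    else Fin.last _, l, hl, fun i => by
      by_cases h : (i : ℕ) < l
      · simp [h, hg i h]
      · simp [h]⟩)

section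
variable (t : Fin m) (l : ℕ) (hl : l ≤ r) (g : ℕ → ℕ) (hg : ∀ i < l, g i < c i)

@[simp] lemma lwMk_fst : (lwMk t l hl g hg).1 = t := rfl

@[simp] lemma lwLevel_lwMk : lwLevel (lwMk t l hl g hg) = l := by
  have : ∀ i : Fin r, ((lwMk t l hl g hg).2.1 i : ℕ) < c i ↔ (i : ℕ) < l := fun i => by
    by_cases h : (i : ℕ) < l
    · simp [lwMk, h, hg i h]
    · simp [lwMk, h]
  simp only [lwLevel, this, Fin.card_filter_val_lt]
  omega

lemma idx_lwMk {i : ℕ} (hi : i < l) : idx (lwMk t l hl g hg) i = g i := by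
  simp [idx, lwMk, hi, hi.trans_le hl]

end

/-- The root vertex `w^t`. -/
def lwRoot (t : Fin m) : LWVert m r c := lwMk t 0 (Nat.zero_le r) (fun _ => 0) (by simp)

@[simp] lemma lwRoot_fst (t : Fin m) : (lwRoot t : LWVert m r c).1 = t := rfl

@[simp] lemma lwLevel_lwRoot (t : Fin m) : lwLevel (lwRoot t : LWVert m r c) = 0 := by
  simp [lwRoot]

lemma eq_lwRoot {v : LWVert m r c} (h : lwLevel v = 0) : v = lwRoot v.1 :=
  lwVert_ext rfl (by simp [h]) (by simp [h])

/-- `u` and `v` have the same ancestor at level `j`. -/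
def SameAncestor (j : ℕ) (u v : LWVert m r c) : Prop :=
  u.1 = v.1 ∧ j ≤ lwLevel u ∧ j ≤ lwLevel v ∧ ∀ i < j, idx u i = idx v i

/-- The ancestors of `u` and `v` at level `j + 1` lie in the same clique attached at level `j`. -/
def SameBlock (k : ℕ → ℕ) (j : ℕ) (u v : LWVert m r c) : Prop :=
  SameAncestor j u v ∧ j < lwLevel u ∧ j < lwLevel v ∧
    idx u j % k (j + 1) = idx v j % k (j + 1)

lemma sameAncestor_refl {j : ℕ} {u : LWVert m r c} (h : j ≤ lwLevel u) : SameAncestor j u u :=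
  ⟨rfl, h, h, fun _ _ => rfl⟩

lemma sameBlock_refl (k : ℕ → ℕ) {j : ℕ} {u : LWVert m r c} (h : j < lwLevel u) :
    SameBlock k j u u :=
  ⟨sameAncestor_refl h.le, h, h, rfl⟩

end Vertices

/-! ### Distances -/

section Distances

variable {m r : ℕ} {c : ℕ → ℕ} (k : ℕ → ℕ)

/-- The level-wise regular block graph with arbitrary numbers of children `c`. -/
abbrev lwGraph (m r : ℕ) (k c : ℕ → ℕ) : SimpleGraph (LWVert m r c) :=
  SimpleGraph.fromRel (lwRel m r k c)

variable {k}

lemma adj_cases {u v : LWVert m r c} (h : (lwGraph m r k c).Adj u v) :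
    (lwLevel u = 0 ∧ lwLevel v = 0 ∧ u.1 ≠ v.1) ∨
    (u.1 = v.1 ∧ lwLevel v = lwLevel u + 1 ∧ ∀ i < lwLevel u, idx u i = idx v i) ∨
    (u.1 = v.1 ∧ lwLevel u = lwLevel v + 1 ∧ ∀ i < lwLevel v, idx u i = idx v i) ∨
    (u.1 = v.1 ∧ ∃ i, lwLevel u = i + 1 ∧ lwLevel v = i + 1 ∧
      (∀ j < i, idx u j = idx v j) ∧ idx u i % k (i + 1) = idx v i % k (i + 1)) := by
  have key : ∀ {a b : LWVert m r c} {l : ℕ}, l ≤ r →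
      (∀ i : Fin r, (i : ℕ) < l → a.2.1 i = b.2.1 i) → ∀ i < l, idx a i = idx b i := by
    intro a b l hl h i hi
    simp [idx, hi.trans_le hl, h ⟨i, hi.trans_le hl⟩ hi]
  rcases ((SimpleGraph.fromRel_adj _ _ _).1 h).2 with h | h <;>
    rcases h with ⟨h1, h2, h3⟩ | ⟨h1, h2, h3⟩ | ⟨h1, h2, i, hi, h3, h4, h5⟩
  · exact Or.inl ⟨h1, h2, h3⟩
  · exact Or.inr (Or.inl ⟨h1, h2, fun i hi => (key (lwLevel_le u) h3 i hi).symm⟩)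
  · refine Or.inr (Or.inr (Or.inr ⟨h1, i, hi.symm, by omega, key i.isLt.le h3, ?_⟩))
    simpa [idx] using h5
  · exact Or.inl ⟨h2, h1, h3.symm⟩
  · exact Or.inr (Or.inr (Or.inl ⟨h1.symm, h2, key (lwLevel_le v) h3⟩))
  · refine Or.inr (Or.inr (Or.inr ⟨h1.symm, i, by omega, hi.symm,
      fun j hj => (key i.isLt.le h3 j hj).symm, ?_⟩))
    simpa [idx] using h5.symm

lemma lwLevel_le_of_adj {u v : LWVert m r c} (h : (lwGraph m r k c).Adj u v) :
    lwLevel u ≤ lwLevel v + 1 := by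
  have := adj_cases h
  grind

lemma SameBlock.of_adj_not {j : ℕ} {u a b : LWVert m r c} (ha : SameBlock k j u a)
    (h : (lwGraph m r k c).Adj a b) (hb : ¬ SameBlock k j u b) :
    SameAncestor j u b ∧ lwLevel b = j ∧ lwLevel a = j + 1 := by
  have := adj_cases h
  unfold SameBlock SameAncestor at *
  grind

lemma SameAncestor.of_adj_not {j : ℕ} {u a b : LWVert m r c} (ha : SameAncestor (j + 1) u a)
    (h : (lwGraph m r k c).Adj a b) (hb : ¬ SameAncestor (j + 1) u b) :
    lwLevel a = j + 1 ∧ (lwLevel b = j ∨ lwLevel b = j + 1) := by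
  have := adj_cases h
  unfold SameAncestor at *
  grind

lemma exists_parent {v : LWVert m r c} (h : 0 < lwLevel v) :
    ∃ u : LWVert m r c, u.1 = v.1 ∧ lwLevel v = lwLevel u + 1 ∧ (lwGraph m r k c).Adj v u := by
  have hl := lwLevel_le v
  have hv : ∀ i < lwLevel v - 1, idx v i < c i := fun i hi => idx_lt (by omega)
  refine ⟨lwMk v.1 (lwLevel v - 1) (by omega) (idx v) hv, rfl, by simp; omega, ?_⟩
  rw [SimpleGraph.fromRel_adj]
  refine ⟨fun h' => ?_, Or.inr (Or.inr (Or.inl ⟨rfl, by simp; omega, fun i hi => ?_⟩))⟩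
  · have := congrArg lwLevel h'
    simp at this
    omega
  · rw [lwLevel_lwMk] at hi
    refine Fin.ext ?_
    have := idx_lwMk v.1 (lwLevel v - 1) ((Nat.sub_le _ _).trans hl) (idx v) hv hi
    simpa [idx] using this.symm

lemma lwRoot_adj {s t : Fin m} (h : s ≠ t) :
    (lwGraph m r k c).Adj (lwRoot s) (lwRoot t) := by
  rw [SimpleGraph.fromRel_adj]
  refine ⟨fun h' => h (congrArg Prod.fst h'), Or.inl (Or.inl ⟨by simp, by simp, h⟩)⟩

lemma exists_walk_lwRoot (n : ℕ) : ∀ v : LWVert m r c, lwLevel v = n →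
    ∃ p : (lwGraph m r k c).Walk v (lwRoot v.1), p.length = n := by
  induction n with
  | zero =>
    intro v hv
    exact ⟨SimpleGraph.Walk.nil.copy rfl (eq_lwRoot hv), by simp⟩
  | succ n ih =>
    intro v hv
    obtain ⟨u, hu, hl, ha⟩ := exists_parent (k := k) (v := v) (by omega)
    obtain ⟨p, hp⟩ := ih u (by omega)
    exact ⟨(SimpleGraph.Walk.cons ha p).copy rfl (by rw [hu]), by simp [hp]⟩

lemma lwGraph_connected (hm : 0 < m) : (lwGraph m r k c).Connected := by
  have hr : ∀ v : LWVert m r c, (lwGraph m r k c).Reachable v (lwRoot v.1) := fun v =>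
    ⟨(exists_walk_lwRoot _ v rfl).choose⟩
  have : Nonempty (LWVert m r c) := ⟨lwRoot ⟨0, hm⟩⟩
  refine SimpleGraph.Connected.mk fun u v => (hr u).trans (SimpleGraph.Reachable.trans ?_ (hr v).symm)
  by_cases h : u.1 = v.1
  · rw [h]
  · exact (lwRoot_adj h).reachable

lemma dist_lwRoot_le (v : LWVert m r c) :
    (lwGraph m r k c).dist v (lwRoot v.1) ≤ lwLevel v := by
  obtain ⟨p, hp⟩ := exists_walk_lwRoot (k := k) _ v rfl
  exact hp ▸ SimpleGraph.dist_le p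

lemma dist_le_of_fst_eq (hm : 0 < m) {u v : LWVert m r c} (h : u.1 = v.1) :
    (lwGraph m r k c).dist u v ≤ lwLevel u + lwLevel v := by
  have h1 := dist_lwRoot_le (k := k) u
  have h2 := dist_lwRoot_le (k := k) v
  rw [SimpleGraph.dist_comm] at h2
  have h3 := (lwGraph_connected (r := r) (k := k) (c := c) hm).dist_triangle
    (u := u) (v := lwRoot v.1) (w := v)
  rw [h] at h1
  omega

lemma dist_le_add_one (hm : 0 < m) (u v : LWVert m r c) :
    (lwGraph m r k c).dist u v ≤ lwLevel u + lwLevel v + 1 := by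
  by_cases h : u.1 = v.1
  · exact (dist_le_of_fst_eq hm h).trans (Nat.le_succ _)
  have hc := lwGraph_connected (r := r) (k := k) (c := c) hm
  have h1 := dist_le_of_fst_eq (k := k) hm (u := lwRoot v.1) (v := v) rfl
  have h2 := dist_lwRoot_le (k := k) u
  have h3 := hc.dist_triangle (u := u) (v := lwRoot u.1) (w := v)
  have h4 := hc.dist_triangle (u := lwRoot u.1) (v := lwRoot v.1) (w := v)
  have h5 := SimpleGraph.dist_eq_one_iff_adj.2 (lwRoot_adj (r := r) (k := k) (c := c) h)
  simp only [lwLevel_lwRoot] at h1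
  omega

lemma sub_le_dist {V : Type*} {G : SimpleGraph V} (hG : G.Connected) (h : V → ℤ)
    (hh : ∀ a b, G.Adj a b → h a ≤ h b + 1) (u v : V) : h v - h u ≤ G.dist u v := by
  obtain ⟨p, hp⟩ := hG.exists_walk_length_eq_dist u v
  rw [← hp]
  clear hp
  induction p with
  | nil => simp
  | cons ha p ih =>
    have := hh _ _ ha.symm
    push_cast [SimpleGraph.Walk.length_cons]
    omega

lemma lwLevel_le_dist_add (hm : 0 < m) (u v : LWVert m r c) :
    lwLevel v ≤ (lwGraph m r k c).dist u v + lwLevel u := by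
  have := sub_le_dist (lwGraph_connected (r := r) (k := k) (c := c) hm)
    (fun z => (lwLevel z : ℤ)) (fun a b h => by exact_mod_cast lwLevel_le_of_adj h) u v
  omega

lemma le_dist_of_not_sameBlock (hm : 0 < m) {j : ℕ} {u v : LWVert m r c}
    (h : ¬ SameBlock k j u v) :
    lwLevel u + lwLevel v ≤ (lwGraph m r k c).dist u v + 2 * j := by
  by_cases hu : j < lwLevel u
  · have := sub_le_dist (lwGraph_connected (r := r) (k := k) (c := c) hm)
      (fun z => if SameBlock k j u z then (j : ℤ) - lwLevel z else (lwLevel z : ℤ) - j)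
      (fun a b hab => by
        have h1 := lwLevel_le_of_adj hab
        have h2 := lwLevel_le_of_adj hab.symm
        have h3 : SameBlock k j u a → ¬ SameBlock k j u b → _ := fun ha hb => ha.of_adj_not hab hb
        have h4 : SameBlock k j u b → ¬ SameBlock k j u a → _ :=
          fun hb ha => hb.of_adj_not hab.symm ha
        split_ifs <;> grind) u v
    simp only [h, sameBlock_refl k hu, if_true, if_false] at this
    omega
  · have := lwLevel_le_dist_add (k := k) hm u v
    omega

lemma le_dist_of_not_sameAncestor (hm : 0 < m) {j : ℕ} {u v : LWVert m r c}
    (h : ¬ SameAncestor (j + 1) u v) :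
    lwLevel u + lwLevel v ≤ (lwGraph m r k c).dist u v + 2 * j + 1 := by
  by_cases hu : j < lwLevel u
  · have := sub_le_dist (lwGraph_connected (r := r) (k := k) (c := c) hm)
      (fun z => if SameAncestor (j + 1) u z then (j : ℤ) + 1 - lwLevel z else (lwLevel z : ℤ) - j)
      (fun a b hab => by
        have h1 := lwLevel_le_of_adj hab
        have h2 := lwLevel_le_of_adj hab.symm
        have h3 : SameAncestor (j + 1) u a → ¬ SameAncestor (j + 1) u b → _ :=
          fun ha hb => ha.of_adj_not hab hb
        have h4 : SameAncestor (j + 1) u b → ¬ SameAncestor (j + 1) u a → _ :=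
          fun hb ha => hb.of_adj_not hab.symm ha
        split_ifs <;> grind) u v
    simp only [h, sameAncestor_refl hu, if_true, if_false] at this
    omega
  · have := lwLevel_le_dist_add (k := k) hm u v
    omega

lemma le_dist_of_fst_ne (hm : 0 < m) {u v : LWVert m r c} (h : u.1 ≠ v.1) :
    lwLevel u + lwLevel v + 1 ≤ (lwGraph m r k c).dist u v := by
  have := sub_le_dist (lwGraph_connected (r := r) (k := k) (c := c) hm)
    (fun z => if z.1 = u.1 then -(lwLevel z : ℤ) else (lwLevel z : ℤ) + 1)
    (fun a b hab => by
      have h1 := adj_cases hab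
      split_ifs <;> grind) u v
  simp only [h.symm, if_true, if_false] at this
  omega

end Distances

/-! ### Radio numbers from orderings of the vertices -/

section RadioNumber

lemma IsRadioLabeling.exists_label_sub_ge {G : SimpleGraph V} {f L : V → ℕ} {R e : ℕ}
    (hf : IsRadioLabeling G f) (hd : diam G + e = R)
    (hdist : ∀ u v, G.dist u v + e ≤ L u + L v + 1) (s : Finset V) (hs : s.Nonempty) :
    ∃ a ∈ s, ∃ b ∈ s, (∀ x ∈ s, f x ≤ f b) ∧ (1 < s.card → a ≠ b) ∧
      ((s.card : ℤ) - 1) * R - 2 * ∑ v ∈ s, (L v : ℤ) + L a + L b ≤ (f b : ℤ) - f a := by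
  induction s using Finset.induction_on_max_value f with
  | empty => exact absurd hs (by simp)
  | insert x s hx hmax ih =>
    rcases s.eq_empty_or_nonempty with rfl | hne
    · exact ⟨x, by simp, x, by simp, by simp, by simp, by simp; omega⟩
    obtain ⟨a, ha, b, hb, hbmax, -, hab⟩ := ih hne
    refine ⟨a, Finset.mem_insert_of_mem ha, x, Finset.mem_insert_self _ _, ?_,
      fun _ h => hx (h ▸ ha), ?_⟩
    · simpa using hmax
    · have h1 := hf b x (fun h => hx (h ▸ hb))
      have h2 := hdist b x
      have h3 := hmax b hb
      rw [Finset.card_insert_of_notMem hx, Finset.sum_insert hx]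
      push_cast
      have h4 : (R : ℤ) ≤ f x - f b + L b + L x := by omega
      linarith

/-- The labeling determined by an ordering of the vertices and a level function. -/
noncomputable def orderLabeling (L pos : V → ℕ) (R : ℕ) (v : V) : ℕ :=
  ∑ u with pos u < pos v, (R - 2 * L u) - L v

lemma card_filter_between {pos : V → ℕ} (hinj : Function.Injective pos)
    (hpos : ∀ v, pos v ∈ Finset.Icc 1 (Fintype.card V)) (u v : V) :
    (Finset.univ.filter fun t => pos u < pos t ∧ pos t < pos v).card = pos v - pos u - 1 := by
  have himg : Finset.univ.image pos = Finset.Icc 1 (Fintype.card V) :=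
    Finset.eq_of_subset_of_card_le (by simpa [Finset.subset_iff] using hpos)
      (by simp [Finset.card_image_of_injective _ hinj])
  rw [← Nat.card_Ioo, ← Finset.card_image_of_injective _ hinj]
  congr 1
  ext n
  simp only [Finset.mem_image, Finset.mem_filter, Finset.mem_univ, true_and, Finset.mem_Ioo]
  refine ⟨by rintro ⟨t, ht, rfl⟩; exact ht, fun hn => ?_⟩
  have hu := Finset.mem_Icc.1 (hpos u)
  have hv := Finset.mem_Icc.1 (hpos v)
  have : n ∈ Finset.univ.image pos := himg ▸ Finset.mem_Icc.2 ⟨by omega, by omega⟩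
  obtain ⟨t, -, rfl⟩ := Finset.mem_image.1 this
  exact ⟨t, hn, rfl⟩

lemma exists_pos_eq {pos : V → ℕ} (hinj : Function.Injective pos)
    (hpos : ∀ v, pos v ∈ Finset.Icc 1 (Fintype.card V)) {n : ℕ}
    (hn : n ∈ Finset.Icc 1 (Fintype.card V)) : ∃ v, pos v = n := by
  have himg : Finset.univ.image pos = Finset.Icc 1 (Fintype.card V) :=
    Finset.eq_of_subset_of_card_le (by simpa [Finset.subset_iff] using hpos)
      (by simp [Finset.card_image_of_injective _ hinj])
  rw [← himg] at hn
  simpa using hn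

theorem rn_eq_of_ordering {G : SimpleGraph V} {L pos : V → ℕ} {r e : ℕ}
    (hd : diam G + e = 2 * r + 1) (hL : ∀ v, L v ≤ r)
    (hdist : ∀ u v, G.dist u v + e ≤ L u + L v + 1) (hne : ∀ a b, a ≠ b → e ≤ L a + L b)
    (hcard : 1 < Fintype.card V) (hpos : ∀ v, pos v ∈ Finset.Icc 1 (Fintype.card V))
    (hinj : Function.Injective pos) (h1 : ∀ v, pos v = 1 → L v = 0)
    (hlast : ∀ v, pos v = Fintype.card V → L v = e)
    (hcond : ∀ u v, pos u < pos v → L u + L v + 2 ≤ G.dist u v + (pos v - pos u) + e) :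
    (rn G : ℤ) = ((Fintype.card V : ℤ) - 1) * (2 * r + 1) - 2 * ∑ v, (L v : ℤ) + e := by
  set f := orderLabeling L pos (2 * r + 1) with hf
  set S : V → ℕ := fun v => ∑ u with pos u < pos v, (2 * r + 1 - 2 * L u) with hS
  have hfS : ∀ v, f v = S v - L v := fun v => rfl
  have hstep : ∀ u v, pos u < pos v →
      S u + (2 * r + 1 - 2 * L u) + (pos v - pos u - 1) ≤ S v := by
    intro u v huv
    rw [← card_filter_between hinj hpos u v, Finset.card_eq_sum_ones]
    have hdis : Disjoint (Finset.univ.filter fun t => pos t < pos u) {u} := by simp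
    have hdis' : Disjoint ((Finset.univ.filter fun t => pos t < pos u) ∪ {u})
        (Finset.univ.filter fun t => pos u < pos t ∧ pos t < pos v) := by
      rw [Finset.disjoint_left]
      intro t
      simp only [Finset.mem_union, Finset.mem_filter, Finset.mem_univ, true_and,
        Finset.mem_singleton]
      rintro (h | rfl) <;> omega
    calc _ ≤ S u + (2 * r + 1 - 2 * L u) +
          ∑ t with pos u < pos t ∧ pos t < pos v, (2 * r + 1 - 2 * L t) := by
            gcongr with t
            have := hL t
            omega
      _ = ∑ t ∈ (Finset.univ.filter fun t => pos t < pos u) ∪ {u} ∪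
          (Finset.univ.filter fun t => pos u < pos t ∧ pos t < pos v), (2 * r + 1 - 2 * L t) := by
            rw [Finset.sum_union hdis', Finset.sum_union hdis, Finset.sum_singleton]
      _ ≤ S v := by
            refine Finset.sum_le_sum_of_subset fun t => ?_
            simp only [Finset.mem_union, Finset.mem_filter, Finset.mem_univ, true_and,
              Finset.mem_singleton]
            rintro ((h | rfl) | h) <;> omega
  obtain ⟨a, ha⟩ := exists_pos_eq hinj hpos (n := 1) (Finset.mem_Icc.2 ⟨le_rfl, hcard.le⟩)
  obtain ⟨b, hb⟩ := exists_pos_eq hinj hpos (n := Fintype.card V)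
    (Finset.mem_Icc.2 ⟨hcard.le, le_rfl⟩)
  have hSL : ∀ v, L v ≤ S v := by
    intro v
    have hv := Finset.mem_Icc.1 (hpos v)
    rcases hv.1.eq_or_lt with h | h
    · rw [h1 v h.symm]
      exact Nat.zero_le _
    · have h2 := hstep a v (by omega)
      have h3 := h1 a ha
      have h4 := hL v
      omega
  have hfdiff : ∀ u v, pos u < pos v →
      2 * r + (pos v - pos u) + f u ≤ f v + L u + L v := by
    intro u v huv
    have h2 := hstep u v huv
    have h3 := hSL u
    have h4 := hSL v
    have h5 := hL u
    have h6 := hfS u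
    have h7 := hfS v
    omega
  have hradio : IsRadioLabeling G f := by
    intro u v huv
    rcases lt_or_gt_of_ne (hinj.ne huv) with h | h
    · have h2 := hfdiff u v h
      have h3 := hcond u v h
      omega
    · have h2 := hfdiff v u h
      have h3 := hcond v u h
      rw [SimpleGraph.dist_comm] at h3
      omega
  have hSb : (S b : ℤ) = ((Fintype.card V : ℤ) - 1) * (2 * r + 1) - 2 * ∑ v, (L v : ℤ)
      + 2 * e := by
    have h2 : (Finset.univ.filter fun t => pos t < pos b) = Finset.univ.erase b := by
      ext t
      have ht := Finset.mem_Icc.1 (hpos t)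
      have := hinj.ne_iff (x := t) (y := b)
      simp only [Finset.mem_filter, Finset.mem_univ, true_and, Finset.mem_erase, and_true]
      rw [← this]
      omega
    have h3 : ∀ t, ((2 * r + 1 - 2 * L t : ℕ) : ℤ) = (2 * r + 1) - 2 * L t := by
      intro t
      have := hL t
      omega
    have h4 := Finset.add_sum_erase Finset.univ
      (fun t => (2 * (r : ℤ) + 1) - 2 * L t) (Finset.mem_univ b)
    have h5 : ∑ t, ((2 * (r : ℤ) + 1) - 2 * L t) =
        Fintype.card V * (2 * r + 1) - 2 * ∑ t, (L t : ℤ) := by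
      simp [Finset.sum_sub_distrib, Finset.mul_sum]
    rw [h5, hlast b hb] at h4
    simp only [hS, h2]
    push_cast [h3]
    linarith
  have hfb : ∀ v, f v ≤ f b := by
    intro v
    by_cases hv : v = b
    · rw [hv]
    · have hv' := Finset.mem_Icc.1 (hpos v)
      have := hinj.ne hv
      have h2 := hfdiff v b (by omega)
      have h3 := hL v
      have h4 := hL b
      omega
  apply le_antisymm
  · have h2 : rn G ≤ f b := by
      refine le_trans (Nat.sInf_le ⟨f, hradio, rfl⟩) (Finset.sup_le fun p _ => ?_)
      exact (Nat.sub_le _ _).trans (hfb _)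
    have h3 := hfS b
    have h4 := hSL b
    have h5 := hlast b hb
    omega
  · obtain ⟨g, hg, hgs⟩ : rn G ∈ {s | ∃ f : V → ℕ, IsRadioLabeling G f ∧ span f = s} :=
      Nat.sInf_mem ⟨_, f, hradio, rfl⟩
    obtain ⟨x, -, y, -, -, hxy, h2⟩ := hg.exists_label_sub_ge hd hdist Finset.univ ⟨a, by simp⟩
    have h3 := hne x y (hxy (by simpa using hcard))
    have h4 : g y - g x ≤ span g :=
      Finset.le_sup (f := fun p : V × V => g p.1 - g p.2) (Finset.mem_univ (y, x))
    rw [← hgs]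
    simp only [Finset.card_univ] at h2
    push_cast at h2
    omega

end RadioNumber

/-! ### Blocks -/

section Blocks

lemma not_twoConn_of_separation {V : Type*} {G : SimpleGraph V} {S : Set V} (P : V → Prop)
    {x u v : V} (hu : u ∈ S) (hv : v ∈ S) (hux : u ≠ x) (hvx : v ≠ x) (hPu : P u) (hPv : ¬ P v)
    (hcross : ∀ a b, G.Adj a b → P a → ¬ P b → a = x ∨ b = x) : ¬ TwoConn G S := by
  rintro ⟨hS, hcut⟩
  have hconn : (G.induce (S \ {x})).Connected := by
    by_cases hx : x ∈ S
    · exact (hcut x hx).resolve_left (Set.Nonempty.ne_empty ⟨u, hu, hux⟩)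
    · rwa [Set.sdiff_singleton_eq_self hx]
  obtain ⟨p⟩ := hconn.preconnected ⟨u, hu, hux⟩ ⟨v, hv, hvx⟩
  have key : ∀ {a b : (S \ {x} : Set V)}, (G.induce (S \ {x})).Walk a b → P a → P b := by
    intro a b p
    induction p with
    | nil => exact id
    | @cons a b _ h _ ih =>
      refine fun ha => ih (by_contra fun hb => ?_)
      rcases hcross a b h ha hb with h' | h'
      · exact a.2.2 h'
      · exact b.2.2 h'
  exact hPv (key p hPu)

variable {m r : ℕ} {k c : ℕ → ℕ}

lemma adj_of_sameBlock {j : ℕ} {u v : LWVert m r c} (h : SameBlock k j u v)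
    (hu : lwLevel u = j + 1) (hv : lwLevel v = j + 1) (hne : u ≠ v) :
    (lwGraph m r k c).Adj u v := by
  have hj : j < r := by
    have := lwLevel_le u
    omega
  obtain ⟨⟨h1, -, -, h2⟩, -, -, h3⟩ := h
  rw [SimpleGraph.fromRel_adj]
  refine ⟨hne, Or.inl (Or.inr (Or.inr ⟨h1, by omega, ⟨j, hj⟩, hu.symm, fun i hi => ?_, ?_, ?_⟩))⟩
  · exact Fin.ext (by simpa [idx] using h2 i hi)
  · refine fun h' => hne (lwVert_ext h1 (by omega) fun i hi => ?_)
    rcases Nat.lt_succ_iff_lt_or_eq.1 (hu ▸ hi) with hi | rfl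
    · exact h2 i hi
    · simp [idx, hj, h']
  · simpa [idx, hj] using h3

lemma isClique_of_twoConn {S : Set (LWVert m r c)} (hS : TwoConn (lwGraph m r k c) S) :
    (lwGraph m r k c).IsClique S := by
  have key : ∀ u ∈ S, ∀ v ∈ S, lwLevel v ≤ lwLevel u → u ≠ v → (lwGraph m r k c).Adj u v := by
    intro u hu v hv hle hne
    by_contra hadj
    rcases Nat.eq_zero_or_pos (lwLevel u) with h0 | h0
    · refine hadj ?_
      rw [eq_lwRoot h0, eq_lwRoot (v := v) (by omega)] at hne ⊢
      exact lwRoot_adj fun h => hne (by rw [h])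
    obtain ⟨p, hp, hpl, hup⟩ := exists_parent (k := k) h0
    have hpb := (sameBlock_refl k (u := u) (j := lwLevel p) (by omega)).of_adj_not hup
      (fun h => lt_irrefl _ h.2.2.1)
    have hvp : v ≠ p := fun h => hadj (h ▸ hup)
    by_cases hb : SameBlock k (lwLevel p) u v
    · exact hadj (adj_of_sameBlock hb hpl (by have := hb.2.2.1; omega) hne)
    · refine not_twoConn_of_separation (SameBlock k (lwLevel p) u) hu hv hup.ne hvp
        (sameBlock_refl k (by omega)) hb (fun a b hab ha hb' => Or.inr ?_) hS
      obtain ⟨⟨h1, -, -, h2⟩, h3, -⟩ := ha.of_adj_not hab hb'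
      obtain ⟨-, -, -, h4⟩ := hpb.1
      exact lwVert_ext (h1.symm.trans hp.symm) h3 fun i hi =>
        (h2 i (h3 ▸ hi)).symm.trans (h4 i (h3 ▸ hi))
  intro u hu v hv hne
  rcases le_total (lwLevel v) (lwLevel u) with h | h
  · exact key u hu v hv h hne
  · exact (key v hv u hu h hne.symm).symm

lemma isBlockGraph_lwGraph (hm : 0 < m) : IsBlockGraph (lwGraph m r k c) :=
  ⟨lwGraph_connected hm, fun _ hS => isClique_of_twoConn hS.1⟩

lemma connected_induce_of_isClique {V : Type*} {G : SimpleGraph V} {S : Set V}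
    (hS : G.IsClique S) (hne : S.Nonempty) : (G.induce S).Connected := by
  have := hne.to_subtype
  refine SimpleGraph.Connected.mk fun a b => ?_
  by_cases h : a = b
  · rw [h]
  · exact SimpleGraph.Adj.reachable (hS a.2 b.2 fun h' => h (Subtype.ext h'))

lemma isClique_roots : (lwGraph m r k c).IsClique {v | lwLevel v = 0} := by
  intro u hu v hv hne
  rw [eq_lwRoot hu, eq_lwRoot hv] at hne ⊢
  exact lwRoot_adj fun h => hne (by rw [h])

lemma eq_roots_of_twoConn (hm : 2 ≤ m) {T : Set (LWVert m r c)}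
    (hT : TwoConn (lwGraph m r k c) T) (hsub : {v | lwLevel v = 0} ⊆ T) :
    T = {v | lwLevel v = 0} := by
  refine Set.Subset.antisymm (fun v hv => ?_) hsub
  by_contra hl
  have : ∃ t : Fin m, t ≠ v.1 := by
    have : Nontrivial (Fin m) := Fin.nontrivial_iff_two_le.2 hm
    exact exists_ne _
  obtain ⟨t, ht⟩ := this
  have hadj := adj_cases (isClique_of_twoConn hT hv (hsub (lwLevel_lwRoot t))
    fun h => hl (h ▸ lwLevel_lwRoot t))
  simp only [Set.mem_ofPred_eq] at hl
  simp [hl, ht.symm] at hadj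

lemma isBlock_roots (hm : 2 ≤ m) : IsBlock (lwGraph m r k c) {v | lwLevel v = 0} := by
  refine ⟨⟨connected_induce_of_isClique isClique_roots ⟨lwRoot ⟨0, by omega⟩, by simp⟩,
    fun v _ => ?_⟩, fun T hsub hT => eq_roots_of_twoConn hm hT hsub⟩
  rcases Set.eq_empty_or_nonempty ({v | lwLevel v = 0} \ {v} : Set (LWVert m r c)) with h | h
  · exact Or.inl h
  · exact Or.inr (connected_induce_of_isClique (isClique_roots.subset Set.sdiff_subset) h)

end Blocks

/-! ### Weight centers and levels -/

section Centers

variable {m r : ℕ} {k c : ℕ → ℕ}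

lemma dist_lwRoot (hm : 0 < m) (u : LWVert m r c) (t : Fin m) :
    (lwGraph m r k c).dist u (lwRoot t) = lwLevel u + if u.1 = t then 0 else 1 := by
  split_ifs with h
  · have h1 := dist_le_of_fst_eq (k := k) hm (u := u) (v := lwRoot t) h
    have h2 := lwLevel_le_dist_add (k := k) hm (lwRoot t) u
    rw [SimpleGraph.dist_comm] at h2
    simp only [lwLevel_lwRoot] at h1 h2
    omega
  · have h1 := dist_le_add_one (k := k) hm u (lwRoot t)
    have h2 := le_dist_of_fst_ne (k := k) hm (u := u) (v := lwRoot t) h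
    simp only [lwLevel_lwRoot] at h1 h2
    omega

lemma card_fst_eq (t : Fin m) :
    (Finset.univ.filter fun v : LWVert m r c => v.1 = t).card * m =
      Fintype.card (LWVert m r c) := by
  have : (Finset.univ.filter fun v : LWVert m r c => v.1 = t) = {t} ×ˢ Finset.univ := by
    ext v
    simp only [Finset.mem_filter, Finset.mem_univ, true_and, Finset.mem_product,
      Finset.mem_singleton, and_true]
  rw [this, Finset.card_product, Fintype.card_prod, Fintype.card_fin, Finset.card_singleton,
    one_mul, mul_comm, Finset.card_univ]

lemma card_fst_ne_add (t : Fin m) :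
    (Finset.univ.filter fun v : LWVert m r c => v.1 = t).card +
      (Finset.univ.filter fun v : LWVert m r c => ¬ v.1 = t).card =
      Fintype.card (LWVert m r c) := by
  simpa using Finset.card_filter_add_card_filter_not (s := Finset.univ)
    (fun v : LWVert m r c => v.1 = t)

lemma wt_lwRoot_eq (hm : 0 < m) (s t : Fin m) :
    wt (lwGraph m r k c) (lwRoot s) = wt (lwGraph m r k c) (lwRoot t) := by
  have h1 : ∀ t : Fin m, wt (lwGraph m r k c) (lwRoot t) = ∑ u : LWVert m r c, lwLevel u +
      (Finset.univ.filter fun v : LWVert m r c => ¬ v.1 = t).card := by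
    intro t
    simp only [wt, dist_lwRoot hm, Finset.sum_add_distrib, Finset.card_filter]
    simp only [ite_not]
  have h2 := card_fst_eq (r := r) (c := c) s
  have h3 := card_fst_eq (r := r) (c := c) t
  have h4 := Nat.eq_of_mul_eq_mul_right hm (h2.trans h3.symm)
  have h5 := card_fst_ne_add (r := r) (c := c) s
  have h6 := card_fst_ne_add (r := r) (c := c) t
  rw [h1, h1]
  omega

lemma wt_lwRoot_lt_of_three_le (hm : 3 ≤ m) {v : LWVert m r c} (hv : 0 < lwLevel v) :
    wt (lwGraph m r k c) (lwRoot v.1) < wt (lwGraph m r k c) v := by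
  have hm0 : 0 < m := by omega
  have h : ∀ u : LWVert m r c,
      (lwGraph m r k c).dist u (lwRoot v.1) + (if ¬ u.1 = v.1 then lwLevel v else 0) ≤
        (lwGraph m r k c).dist u v + (if u.1 = v.1 then lwLevel v else 0) := by
    intro u
    rw [dist_lwRoot hm0]
    by_cases hu : u.1 = v.1
    · have := lwLevel_le_dist_add (k := k) hm0 v u
      rw [SimpleGraph.dist_comm] at this
      simpa [hu] using this
    · have := le_dist_of_fst_ne (k := k) hm0 hu
      simp only [hu, if_false, not_false_eq_true, if_true]
      omega
  have hsum := Finset.sum_le_sum fun u (_ : u ∈ Finset.univ) => h u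
  simp only [Finset.sum_add_distrib, ← Finset.sum_filter, Finset.sum_const, smul_eq_mul] at hsum
  have h1 := card_fst_eq (r := r) (c := c) v.1
  have h2 := card_fst_ne_add (r := r) (c := c) v.1
  have h3 : 0 < (Finset.univ.filter fun u : LWVert m r c => u.1 = v.1).card :=
    Finset.card_pos.2 ⟨v, by simp⟩
  set x := (Finset.univ.filter fun u : LWVert m r c => u.1 = v.1).card
  set y := (Finset.univ.filter fun u : LWVert m r c => ¬ u.1 = v.1).card
  have h4 : x + 1 ≤ y := by nlinarith
  have h5 := Nat.mul_le_mul_right (lwLevel v) h4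
  rw [add_mul] at h5
  simp only [wt]
  omega

/-- Replace the first index of a vertex. -/
noncomputable def setFirst (a : ℕ) (ha : a < c 0) (u : LWVert m r c) : LWVert m r c :=
  lwMk u.1 (lwLevel u) (lwLevel_le u) (fun i => if i = 0 then a else idx u i) fun i hi => by
    split_ifs with h
    · exact h ▸ ha
    · exact idx_lt hi

lemma card_sameAncestor_lt (hk : 2 ≤ k 1) (hkc : k 1 ≤ c 0) (v : LWVert m r c) :
    (Finset.univ.filter fun u : LWVert m r c => SameAncestor 1 v u).card <
      (Finset.univ.filter fun u : LWVert m r c => ¬ SameBlock k 0 v u).card := by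
  have hlt : (idx v 0 + 1) % k 1 < k 1 := Nat.mod_lt _ (by omega)
  have hne : (idx v 0 + 1) % k 1 ≠ idx v 0 % k 1 := fun h => by
    have h' : idx v 0 + 1 ≡ idx v 0 + 0 [MOD k 1] := h
    have h1 := Nat.ModEq.add_left_cancel' _ h'
    rw [Nat.ModEq, Nat.mod_eq_of_lt (by omega), Nat.zero_mod] at h1
    exact one_ne_zero h1
  set a := (idx v 0 + 1) % k 1
  have hroot : lwRoot v.1 ∈
      (Finset.univ.filter fun u : LWVert m r c => ¬ SameBlock k 0 v u) := by
    simp [SameBlock]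
  rw [← Nat.succ_le_iff, Nat.succ_eq_add_one, ← Nat.le_sub_iff_add_le
    (Finset.card_pos.2 ⟨_, hroot⟩), ← Finset.card_erase_of_mem hroot]
  refine Finset.card_le_card_of_injOn (setFirst a (hlt.trans_le hkc)) ?_ ?_
  · intro u hu
    have hu : SameAncestor 1 v u := by simpa using hu
    have hu0 : 0 < lwLevel u := hu.2.2.1
    simp only [Finset.coe_erase, Finset.coe_filter, Finset.mem_univ, true_and]
    refine ⟨fun h => ?_, fun h => ?_⟩
    · have h4 := h.2.2.2
      rw [setFirst, idx_lwMk _ _ _ _ _ hu0, if_pos rfl, zero_add, Nat.mod_eq_of_lt hlt] at h4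
      exact hne h4.symm
    · have := congrArg lwLevel h
      simp only [setFirst, lwLevel_lwMk, lwLevel_lwRoot] at this
      omega
  · intro u hu w hw huw
    have hu : SameAncestor 1 v u := by simpa using hu
    have hw : SameAncestor 1 v w := by simpa using hw
    have hl : lwLevel u = lwLevel w := by
      simpa only [setFirst, lwLevel_lwMk] using congrArg lwLevel huw
    refine lwVert_ext (hu.1.symm.trans hw.1) hl fun i hi => ?_
    rcases Nat.eq_zero_or_pos i with rfl | h0
    · exact (hu.2.2.2 0 one_pos).symm.trans (hw.2.2.2 0 one_pos)
    · have := congrArg (fun z => idx z i) huw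
      simpa only [setFirst, idx_lwMk _ _ _ _ _ hi, idx_lwMk _ _ _ _ _ (hl ▸ hi), h0.ne',
        if_false] using this

lemma wt_lwRoot_lt_of_eq_one (hm : m = 1) (hk : 2 ≤ k 1) (hkc : k 1 ≤ c 0) {v : LWVert m r c}
    (hv : 0 < lwLevel v) :
    wt (lwGraph m r k c) (lwRoot v.1) < wt (lwGraph m r k c) v := by
  have hm0 : 0 < m := by omega
  have h : ∀ u : LWVert m r c,
      (lwGraph m r k c).dist u (lwRoot v.1) + (if ¬ SameBlock k 0 v u then lwLevel v else 0) ≤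
        (lwGraph m r k c).dist u v + (if SameAncestor 1 v u then lwLevel v else 0) := by
    intro u
    have hu : u.1 = v.1 := by
      subst hm
      exact Subsingleton.elim _ _
    rw [dist_lwRoot hm0, if_pos hu, SimpleGraph.dist_comm]
    by_cases h1 : SameBlock k 0 v u
    · by_cases h2 : SameAncestor 1 v u
      · have := lwLevel_le_dist_add (k := k) hm0 v u
        simpa [h1, h2] using this
      · have := le_dist_of_not_sameAncestor (k := k) (j := 0) hm0 h2
        simp only [h1, h2, if_false, not_true_eq_false]
        omega
    · have := le_dist_of_not_sameBlock hm0 h1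
      simp only [h1, if_true, not_false_eq_true]
      omega
  have hsum := Finset.sum_le_sum fun u (_ : u ∈ Finset.univ) => h u
  simp only [Finset.sum_add_distrib, ← Finset.sum_filter, Finset.sum_const, smul_eq_mul] at hsum
  have h5 := Nat.mul_le_mul_right (lwLevel v) (card_sameAncestor_lt hk hkc v)
  rw [Nat.succ_eq_add_one, add_mul] at h5
  simp only [wt]
  omega

lemma weightCenters_lwGraph (hm : m = 1 ∨ 3 ≤ m) (hk : m = 1 → 2 ≤ k 1 ∧ k 1 ≤ c 0) :
    weightCenters (lwGraph m r k c) = {v | lwLevel v = 0} := by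
  have hm0 : 0 < m := by omega
  have hlt : ∀ v : LWVert m r c, 0 < lwLevel v →
      wt (lwGraph m r k c) (lwRoot v.1) < wt (lwGraph m r k c) v := fun v hv => by
    rcases hm with h | h
    · exact wt_lwRoot_lt_of_eq_one h (hk h).1 (hk h).2 hv
    · exact wt_lwRoot_lt_of_three_le h hv
  ext v
  refine ⟨fun hv => ?_, fun hv u => ?_⟩
  · by_contra h
    exact (hlt v (Nat.pos_of_ne_zero h)).not_ge (hv _)
  · rw [eq_lwRoot hv, wt_lwRoot_eq hm0 v.1 u.1]
    rcases Nat.eq_zero_or_pos (lwLevel u) with h | h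
    · rw [← eq_lwRoot h]
    · exact (hlt u h).le

lemma ncard_roots : ({v | lwLevel v = 0} : Set (LWVert m r c)).ncard = m := by
  have : ({v | lwLevel v = 0} : Set (LWVert m r c)) = Set.range lwRoot :=
    Set.ext fun v => ⟨fun h => ⟨v.1, (eq_lwRoot h).symm⟩, by rintro ⟨t, rfl⟩; simp⟩
  rw [this, Set.ncard_range_of_injective fun s t h => congrArg Prod.fst h, Nat.card_fin]

lemma eps_lwGraph (hm : m = 1 ∨ 3 ≤ m) (hk : m = 1 → 2 ≤ k 1 ∧ k 1 ≤ c 0) :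
    eps (lwGraph m r k c) = if m = 1 then 1 else 0 := by
  rw [eps, weightCenters_lwGraph hm hk, ncard_roots]

lemma isCentral_lwGraph_iff (hm : m = 1 ∨ 3 ≤ m) (hk : m = 1 → 2 ≤ k 1 ∧ k 1 ≤ c 0)
    (w : LWVert m r c) : IsCentral (lwGraph m r k c) w ↔ lwLevel w = 0 := by
  rw [IsCentral, weightCenters_lwGraph hm hk, ncard_roots]
  constructor
  · rintro (h | ⟨h, S, hS, hsub, hw⟩)
    · exact (h ▸ rfl : w ∈ {v : LWVert m r c | lwLevel v = 0})
    · rwa [eq_roots_of_twoConn h hS.1 hsub] at hw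
  · intro hw
    rcases hm with h | h
    · refine Or.inl (Set.ext fun v => ⟨fun hv => ?_, ?_⟩)
      · subst h
        exact lwVert_ext (Subsingleton.elim _ _) (hv.trans hw.symm)
          (by rw [show lwLevel v = 0 from hv]; simp)
      · rintro rfl
        exact hw
    · exact Or.inr ⟨by omega, _, isBlock_roots (by omega), subset_rfl, hw⟩

lemma level_lwGraph (hm : m = 1 ∨ 3 ≤ m) (hk : m = 1 → 2 ≤ k 1 ∧ k 1 ≤ c 0)
    (v : LWVert m r c) : level (lwGraph m r k c) v = lwLevel v := by
  have hm0 : 0 < m := by omega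
  simp only [level, isCentral_lwGraph_iff hm hk]
  refine (IsLeast.csInf_eq ⟨⟨lwRoot v.1, by simp, by simp [dist_lwRoot hm0]⟩, ?_⟩)
  rintro n ⟨w, hw, rfl⟩
  have := lwLevel_le_dist_add (k := k) hm0 w v
  rw [SimpleGraph.dist_comm] at this
  omega

lemma diam_lwGraph (hm : m = 1 ∨ 3 ≤ m) (hk : m = 1 → 2 ≤ k 1) (hr : 0 < r)
    (hc : ∀ i < r, 2 ≤ c i) :
    diam (lwGraph m r k c) + (if m = 1 then 1 else 0) = 2 * r + 1 := by
  have hm0 : 0 < m := by omega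
  have hle : ∀ u v : LWVert m r c, (lwGraph m r k c).dist u v ≤ diam (lwGraph m r k c) :=
    fun u v => Finset.le_sup (f := fun p : LWVert m r c × LWVert m r c =>
      (lwGraph m r k c).dist p.1 p.2) (Finset.mem_univ (u, v))
  have h0 : ∀ i < r, (fun _ : ℕ => 0) i < c i := fun i hi =>
    two_pos.trans_le (hc i hi)
  have h1 : ∀ i < r, (fun _ : ℕ => 1) i < c i := fun i hi => hc i hi
  split_ifs with h
  · refine congrArg (· + 1) (le_antisymm (Finset.sup_le fun p _ => ?_) ?_)
    · have h2 := dist_le_of_fst_eq (k := k) hm0 (u := p.1) (v := p.2)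
        (by subst h; exact Subsingleton.elim _ _)
      have h3 := lwLevel_le p.1
      have h4 := lwLevel_le p.2
      omega
    · refine le_trans ?_ (hle (lwMk ⟨0, hm0⟩ r le_rfl _ h0) (lwMk ⟨0, hm0⟩ r le_rfl _ h1))
      have := le_dist_of_not_sameBlock (k := k) (j := 0) hm0
        (u := lwMk ⟨0, hm0⟩ r le_rfl _ h0) (v := lwMk ⟨0, hm0⟩ r le_rfl _ h1) fun hb => by
          have hb' := hb.2.2.2
          have hk1 := hk h
          rw [idx_lwMk _ _ _ _ _ hr, idx_lwMk _ _ _ _ _ hr, Nat.zero_mod, zero_add,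
            Nat.mod_eq_of_lt (by omega)] at hb'
          omega
      simp only [lwLevel_lwMk] at this
      omega
  · refine le_antisymm (Finset.sup_le fun p _ => ?_) ?_
    · have h2 := dist_le_add_one (k := k) hm0 p.1 p.2
      have h3 := lwLevel_le p.1
      have h4 := lwLevel_le p.2
      omega
    · refine le_trans ?_ (hle (lwMk ⟨0, hm0⟩ r le_rfl _ h0) (lwMk ⟨1, by omega⟩ r le_rfl _ h0))
      have := le_dist_of_fst_ne (k := k) hm0
        (u := lwMk ⟨0, hm0⟩ r le_rfl _ h0) (v := lwMk ⟨1, by omega⟩ r le_rfl _ h0) (by simp)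
      simp only [lwLevel_lwMk] at this
      omega

end Centers

/-! ### Counting vertices and ordering them -/

section Ordering

variable {m r : ℕ} {k c : ℕ → ℕ}

/-- The number of vertices of level `l`. -/
def levelCard (m : ℕ) (c : ℕ → ℕ) (l : ℕ) : ℕ := m * ∏ j ∈ Finset.range l, c j

lemma levelCard_zero : levelCard m c 0 = m := by simp [levelCard]

lemma levelCard_succ (l : ℕ) : levelCard m c (l + 1) = levelCard m c l * c l := by
  simp [levelCard, Finset.prod_range_succ, mul_assoc]

lemma levelCard_dvd {i j : ℕ} (h : i ≤ j) : levelCard m c i ∣ levelCard m c j :=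
  Nat.mul_dvd_mul_left _ (Finset.prod_dvd_prod_of_subset _ _ _ (by simpa using h))

lemma levelCard_pos (hm : 0 < m) {j : ℕ} (hc : ∀ i < j, 0 < c i) : 0 < levelCard m c j :=
  Nat.mul_pos hm (Finset.prod_pos fun i hi => hc i (Finset.mem_range.1 hi))

lemma card_lwLevel_eq {l : ℕ} (hl : l ≤ r) :
    (Finset.univ.filter fun v : LWVert m r c => lwLevel v = l).card = levelCard m c l := by
  let F : Fin m × ((i : Fin l) → Fin (c i)) → {v : LWVert m r c // lwLevel v = l} := fun x =>
    ⟨lwMk x.1 l hl (fun i => if h : i < l then x.2 ⟨i, h⟩ else 0)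
      (fun i hi => by simp [hi]), by simp⟩
  have hF : Function.Bijective F := by
    constructor
    · intro x y hxy
      have h := congrArg Subtype.val hxy
      have h1 : x.1 = y.1 := congrArg (fun v : LWVert m r c => v.1) h
      refine Prod.ext h1 (funext fun i => Fin.ext ?_)
      have hi := congrArg (fun v => idx v i) h
      simpa only [F, idx_lwMk _ _ _ _ _ i.isLt, i.isLt, dif_pos] using hi
    · rintro ⟨v, hv⟩
      refine ⟨(v.1, fun i => ⟨idx v i, idx_lt (hv ▸ i.isLt)⟩), Subtype.ext
        (lwVert_ext rfl (by simp [F, hv]) fun i hi => ?_)⟩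
      have hi' : i < l := by simpa [F] using hi
      simp only [F, idx_lwMk _ _ _ _ _ hi', hi', dif_pos]
  rw [← Fintype.card_subtype, ← Fintype.card_of_bijective hF, Fintype.card_prod, Fintype.card_pi,
    Fintype.card_fin, levelCard, ← Fin.prod_univ_eq_prod_range]
  simp

lemma sum_lwLevel (F : ℕ → ℕ) :
    ∑ v : LWVert m r c, F (lwLevel v) = ∑ l ∈ Finset.range (r + 1), levelCard m c l * F l := by
  rw [← Finset.sum_fiberwise_of_maps_to (s := Finset.univ) (t := Finset.range (r + 1))
    (g := lwLevel) fun v _ => Finset.mem_range.2 (Nat.lt_succ_of_le (lwLevel_le v))]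
  refine Finset.sum_congr rfl fun l hl => ?_
  rw [← card_lwLevel_eq (r := r) (Nat.lt_succ_iff.1 (Finset.mem_range.1 hl)), ← smul_eq_mul,
    ← Finset.sum_const]
  exact Finset.sum_congr rfl fun v hv => by rw [(Finset.mem_filter.1 hv).2]

lemma card_lwVert : Fintype.card (LWVert m r c) = ∑ l ∈ Finset.range (r + 1), levelCard m c l := by
  simpa using sum_lwLevel (m := m) (r := r) (c := c) fun _ => 1

/-- The rank determined by the root and the first `j` child indices of a vertex. -/
def partialRank (v : LWVert m r c) (j : ℕ) : ℕ :=
  v.1 + ∑ i ∈ Finset.range j, (idx v i + 1) * levelCard m c i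

/-- The rank of a vertex: its indices are the digits of a bijective mixed-radix numeration,
with the root as the least significant digit. -/
noncomputable def rank (v : LWVert m r c) : ℕ := partialRank v (lwLevel v)

lemma partialRank_zero (v : LWVert m r c) : partialRank v 0 = v.1 := by simp [partialRank]

lemma partialRank_succ (v : LWVert m r c) (j : ℕ) :
    partialRank v (j + 1) = partialRank v j + (idx v j + 1) * levelCard m c j := by
  simp [partialRank, Finset.sum_range_succ, add_assoc]

lemma partialRank_mono (v : LWVert m r c) : Monotone (partialRank v) :=
  monotone_nat_of_le_succ fun j => by
    rw [partialRank_succ]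
    exact Nat.le_add_right _ _

lemma partialRank_modEq (v : LWVert m r c) {j n : ℕ} (h : j ≤ n) :
    partialRank v n ≡ partialRank v j [MOD levelCard m c j] := by
  induction n, h using Nat.le_induction with
  | base => rfl
  | succ n hn ih =>
    rw [partialRank_succ]
    exact ((Nat.modEq_zero_iff_dvd.2 ((levelCard_dvd hn).mul_left _)).add_left _).trans ih

lemma SameAncestor.partialRank_eq {j : ℕ} {u v : LWVert m r c} (h : SameAncestor j u v) :
    partialRank u j = partialRank v j := by
  rw [partialRank, partialRank, h.1]
  exact congrArg _ (Finset.sum_congr rfl fun i hi => by rw [h.2.2.2 i (Finset.mem_range.1 hi)])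

lemma rank_modEq (v : LWVert m r c) {j : ℕ} (h : j ≤ lwLevel v) :
    rank v ≡ partialRank v j [MOD levelCard m c j] :=
  partialRank_modEq v h

lemma partialRank_lt (v : LWVert m r c) {j : ℕ} (h : j ≤ lwLevel v) :
    partialRank v j < ∑ i ∈ Finset.range (j + 1), levelCard m c i := by
  induction j with
  | zero => simp [partialRank_zero, levelCard_zero]
  | succ j ih =>
    rw [partialRank_succ, Finset.sum_range_succ, levelCard_succ, mul_comm (levelCard m c j)]
    exact add_lt_add_of_lt_of_le (ih (by omega)) (Nat.mul_le_mul_right _ (idx_lt h))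

lemma rank_lt (v : LWVert m r c) : rank v < Fintype.card (LWVert m r c) := by
  rw [card_lwVert]
  exact (partialRank_lt v le_rfl).trans_le (Finset.sum_le_sum_of_subset
    (Finset.range_mono (Nat.succ_le_succ (lwLevel_le v))))

lemma rank_injective (hm : 0 < m) (hc : ∀ i < r, 0 < c i) :
    Function.Injective (rank : LWVert m r c → ℕ) := by
  have key : ∀ u v : LWVert m r c, rank u = rank v → ∀ j ≤ lwLevel u, SameAncestor j u v := by
    intro u v huv j
    induction j with
    | zero =>
      intro _
      refine ⟨Fin.ext ?_, Nat.zero_le _, Nat.zero_le _, by simp⟩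
      have h := ((rank_modEq u (Nat.zero_le _)).symm.trans (huv ▸ rfl)).trans
        (rank_modEq v (Nat.zero_le _))
      rw [levelCard_zero, partialRank_zero, partialRank_zero] at h
      exact h.eq_of_lt_of_lt u.1.isLt v.1.isLt
    | succ j ih =>
      intro hj
      have hs := ih (by omega)
      have hpos : 0 < levelCard m c j :=
        levelCard_pos hm fun i hi => hc i (by have := lwLevel_le u; omega)
      have hv : j < lwLevel v := by
        refine lt_of_le_of_ne hs.2.2.1 fun h => ?_
        have h1 : partialRank u (j + 1) ≤ rank u := partialRank_mono u hj
        rw [huv, rank, ← h, partialRank_succ, hs.partialRank_eq] at h1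
        have := Nat.mul_pos (Nat.succ_pos (idx u j)) hpos
        simp only [Nat.succ_eq_add_one] at this
        omega
      have h := ((rank_modEq u hj).symm.trans (huv ▸ rfl)).trans (rank_modEq v hv)
      rw [partialRank_succ, partialRank_succ, hs.partialRank_eq,
        levelCard_succ, mul_comm (levelCard m c j)] at h
      have h2 := Nat.ModEq.add_right_cancel' _ (Nat.ModEq.mul_right_cancel' hpos.ne'
        (Nat.ModEq.add_left_cancel' _ h))
      refine ⟨hs.1, hj, hv, fun i hi => ?_⟩
      rcases Nat.lt_succ_iff_lt_or_eq.1 hi with hi | rfl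
      · exact hs.2.2.2 i hi
      · exact h2.eq_of_lt_of_lt (idx_lt hj) (idx_lt hv)
  intro u v huv
  have h1 := key u v huv _ le_rfl
  have h2 := key v u huv.symm _ le_rfl
  exact lwVert_ext h1.1 (le_antisymm h1.2.2.1 h2.2.2.1) h1.2.2.2

lemma le_rank (v : LWVert m r c) (hv : 0 < lwLevel v) : m ≤ rank v := by
  have h : partialRank v 1 ≤ rank v := partialRank_mono v hv
  rw [partialRank_succ, levelCard_zero] at h
  have := Nat.le_mul_of_pos_left m (Nat.succ_pos (idx v 0))
  simp only [Nat.succ_eq_add_one] at this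
  omega

lemma add_le_levelCard {e : ℕ} (he : m = 1 ∧ e = 1 ∨ 3 ≤ m ∧ e = 0) (hc : ∀ i < r, 2 ≤ c i)
    (h0 : m = 1 → 4 ≤ c 0) {j : ℕ} (hj : j ≤ r) (h : e ≤ j) :
    2 * j + 3 ≤ levelCard m c j + e := by
  induction j, h using Nat.le_induction with
  | base =>
    rcases he with ⟨hm, rfl⟩ | ⟨hm, rfl⟩
    · have := h0 hm
      rw [levelCard_succ, levelCard_zero, hm]
      omega
    · rw [levelCard_zero]
      omega
  | succ j _ ih =>
    have h1 := ih (by omega)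
    have h2 := Nat.mul_le_mul_left (levelCard m c j) (hc j (by omega))
    rw [levelCard_succ]
    omega

/-- The position of a vertex in an optimal ordering: the vertex of rank `e` is moved to the end. -/
noncomputable def position (e : ℕ) (v : LWVert m r c) : ℕ :=
  if rank v = e then Fintype.card (LWVert m r c) else max 1 (rank v)

lemma one_lt_card_lwVert {e : ℕ} (he : m = 1 ∧ e = 1 ∨ 3 ≤ m ∧ e = 0) (hr : 0 < r)
    (hc : ∀ i < r, 2 ≤ c i) : 1 < Fintype.card (LWVert m r c) := by
  have h0 := hc 0 hr
  have h1 : ∑ l ∈ Finset.range 2, levelCard m c l ≤ Fintype.card (LWVert m r c) := by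
    rw [card_lwVert]
    exact Finset.sum_le_sum_of_subset (Finset.range_mono (by omega))
  simp only [Finset.sum_range_succ, Finset.sum_range_zero, levelCard_succ, levelCard_zero] at h1
  have : 0 < m * c 0 := Nat.mul_pos (by omega) (by omega)
  omega

lemma position_mem {e : ℕ} (he : m = 1 ∧ e = 1 ∨ 3 ≤ m ∧ e = 0) (hr : 0 < r)
    (hc : ∀ i < r, 2 ≤ c i)
    (v : LWVert m r c) :
    position e v ∈ Finset.Icc 1 (Fintype.card (LWVert m r c)) := by
  have h1 := rank_lt v
  have h2 := one_lt_card_lwVert he hr hc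
  rw [position, Finset.mem_Icc]
  split_ifs <;> omega

lemma position_injective {e : ℕ} (he : m = 1 ∧ e = 1 ∨ 3 ≤ m ∧ e = 0) (hr : 0 < r)
    (hc : ∀ i < r, 2 ≤ c i) : Function.Injective (position e : LWVert m r c → ℕ) := by
  intro u v h
  have h1 := rank_lt u
  have h2 := rank_lt v
  have h3 := one_lt_card_lwVert he hr hc
  refine rank_injective (by omega) (fun i hi => two_pos.trans_le (hc i hi)) ?_
  rw [position, position] at h
  split_ifs at h <;> omega

lemma lwLevel_of_rank_eq {e : ℕ} (he : m = 1 ∧ e = 1 ∨ 3 ≤ m ∧ e = 0) (hr : 0 < r)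
    (hc : ∀ i < r, 2 ≤ c i)
    {v : LWVert m r c} (h : rank v = e) : lwLevel v = e := by
  rcases he with ⟨hm, rfl⟩ | ⟨hm, rfl⟩
  · rcases lt_trichotomy (lwLevel v) 1 with h1 | h1 | h1
    · have h2 : lwLevel v = 0 := by omega
      rw [rank, h2, partialRank_zero] at h
      have := v.1.isLt
      omega
    · exact h1
    · have h2 : partialRank v 2 ≤ rank v := partialRank_mono v h1
      rw [partialRank_succ, partialRank_succ] at h2
      have h3 : ∀ j ≤ 1, 0 < (idx v j + 1) * levelCard m c j := fun j hj =>
        Nat.mul_pos (Nat.succ_pos _) (levelCard_pos (by omega) fun i hi =>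
          two_pos.trans_le (hc i (by omega)))
      have h4 := h3 0 zero_le_one
      have h5 := h3 1 le_rfl
      omega
  · by_contra h1
    have := le_rank v (Nat.pos_of_ne_zero h1)
    omega

lemma lwLevel_of_position_eq_one {e : ℕ} (he : m = 1 ∧ e = 1 ∨ 3 ≤ m ∧ e = 0) (hr : 0 < r)
    (hc : ∀ i < r, 2 ≤ c i)
    {v : LWVert m r c} (h : position e v = 1) : lwLevel v = 0 := by
  have h3 := one_lt_card_lwVert he hr hc
  rw [position] at h
  split_ifs at h with h'
  · omega
  · by_contra h1
    have := le_rank v (Nat.pos_of_ne_zero h1)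
    omega

lemma lwLevel_of_position_eq_card {e : ℕ} (he : m = 1 ∧ e = 1 ∨ 3 ≤ m ∧ e = 0) (hr : 0 < r)
    (hc : ∀ i < r, 2 ≤ c i)
    {v : LWVert m r c}
    (h : position e v = Fintype.card (LWVert m r c)) : lwLevel v = e := by
  have h1 := rank_lt v
  have h3 := one_lt_card_lwVert he hr hc
  rw [position] at h
  split_ifs at h with h'
  · exact lwLevel_of_rank_eq he hr hc h'
  · omega

lemma position_modEq_rank {e : ℕ} (he : m = 1 ∧ e = 1 ∨ 3 ≤ m ∧ e = 0) (hr : 0 < r)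
    (hc : ∀ i < r, 2 ≤ c i)
    (v : LWVert m r c) {j : ℕ} (hj : j ≤ lwLevel v) :
    position e v ≡ rank v [MOD levelCard m c j] := by
  rw [position]
  split_ifs with h
  · have hl := lwLevel_of_rank_eq he hr hc h
    rw [h, card_lwVert]
    rcases he with ⟨hm, rfl⟩ | ⟨hm, rfl⟩
    · have hs : ∑ l ∈ Finset.range (r + 1), levelCard m c l =
          ∑ l ∈ Finset.range r, levelCard m c (l + 1) + 1 := by
        rw [Finset.sum_range_succ', levelCard_zero, hm]
      rw [hs]
      have hd : levelCard m c j ∣ ∑ l ∈ Finset.range r, levelCard m c (l + 1) :=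
        Finset.dvd_sum fun l _ => levelCard_dvd (by omega)
      simpa using (Nat.modEq_zero_iff_dvd.2 hd).add_right 1
    · exact Nat.modEq_zero_iff_dvd.2 (Finset.dvd_sum fun l _ => levelCard_dvd (by omega))
  · rcases Nat.eq_zero_or_pos (rank v) with h0 | h0
    · have hv : lwLevel v = 0 := by
        by_contra h1
        have := le_rank v (Nat.pos_of_ne_zero h1)
        omega
      obtain rfl : j = 0 := by omega
      have hl0 : levelCard m c 0 = 1 := by
        rw [levelCard_zero]
        omega
      rw [hl0]
      exact Nat.modEq_one
    · rw [max_eq_right h0]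

lemma le_dist_add_position_sub {e : ℕ} (he : m = 1 ∧ e = 1 ∨ 3 ≤ m ∧ e = 0) (hr : 0 < r)
    (hc : ∀ i < r, 2 ≤ c i)
    (hk : m = 1 → 2 ≤ k 1 ∧ k 1 ∣ c 0) (h0 : m = 1 → 4 ≤ c 0)
    {u v : LWVert m r c} (huv : position e u < position e v) :
    lwLevel u + lwLevel v + 2 ≤
      (lwGraph m r k c).dist u v + (position e v - position e u) + e := by
  have hm0 : 0 < m := by omega
  by_cases hfst : u.1 = v.1
  swap
  · have := le_dist_of_fst_ne (k := k) hm0 hfst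
    omega
  have hzero : SameAncestor 0 u v := ⟨hfst, Nat.zero_le _, Nat.zero_le _, by simp⟩
  have hex : ∃ j, SameAncestor j u v ∧ ¬ SameAncestor (j + 1) u v := by
    by_contra! h
    have hall : ∀ j, SameAncestor j u v := fun j => Nat.rec hzero h j
    exact absurd (hall (lwLevel u + 1)).2.1 (by omega)
  obtain ⟨j, hj, hj'⟩ := hex
  have hjr := hj.2.1.trans (lwLevel_le u)
  have hdist := le_dist_of_not_sameAncestor (k := k) hm0 hj'
  have hle : ∀ {d : ℕ}, position e u ≡ position e v [MOD d] →
      d ≤ position e v - position e u := fun h =>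
    Nat.le_of_dvd (Nat.sub_pos_of_lt huv) ((Nat.modEq_iff_dvd' huv.le).1 h)
  have hP := hle <| calc
    position e u ≡ rank u [MOD levelCard m c j] := position_modEq_rank he hr hc u hj.2.1
    _ ≡ partialRank u j [MOD levelCard m c j] := rank_modEq u hj.2.1
    _ = partialRank v j := hj.partialRank_eq
    _ ≡ rank v [MOD levelCard m c j] := (rank_modEq v hj.2.2.1).symm
    _ ≡ position e v [MOD levelCard m c j] := (position_modEq_rank he hr hc v hj.2.2.1).symm
  by_cases hej : e ≤ j
  · have := add_le_levelCard he hc h0 hjr hej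
    omega
  · obtain ⟨rfl, rfl⟩ : e = 1 ∧ j = 0 := by omega
    have hm : m = 1 := by omega
    by_cases hb : SameBlock k 0 u v
    · have hmod : ∀ w : LWVert m r c, 0 < lwLevel w → position 1 w ≡ idx w 0 + 1 [MOD k 1] := by
        intro w hw
        have hw' : position 1 w ≡ partialRank w 1 [MOD levelCard m c 1] :=
          (position_modEq_rank he hr hc w hw).trans (rank_modEq w hw)
        have hw0 : (w.1 : ℕ) = 0 := by
          have := w.1.isLt
          omega
        have hl0 : levelCard m c 0 = 1 := by rw [levelCard_zero, hm]
        have hl1 : levelCard m c 1 = c 0 := by rw [levelCard_succ, hl0, one_mul]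
        rw [partialRank_succ, partialRank_zero, hl1, hl0, hw0, zero_add, mul_one] at hw'
        exact hw'.of_dvd (hk hm).2
      have := hle (((hmod u hb.2.1).trans (Nat.ModEq.add_right 1 hb.2.2.2)).trans
        (hmod v hb.2.2.1).symm)
      have := (hk hm).1
      omega
    · have := le_dist_of_not_sameBlock hm0 hb
      omega

end Ordering

/-! ### The radio number -/

section LowerBound

variable {m r : ℕ} {k c : ℕ → ℕ}

theorem rn_lwGraph (hm : m = 1 ∨ 3 ≤ m) (hr : 0 < r) (hc : ∀ i < r, 2 ≤ c i)
    (hk : m = 1 → 2 ≤ k 1 ∧ k 1 ∣ c 0) (h0 : m = 1 → 4 ≤ c 0) :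
    (rn (lwGraph m r k c) : ℤ) =
      ((Fintype.card (LWVert m r c) : ℤ) - 1) * (2 * r + 1) -
        2 * ∑ v : LWVert m r c, (lwLevel v : ℤ) + (if m = 1 then 1 else 0 : ℕ) := by
  have he : m = 1 ∧ (if m = 1 then 1 else 0) = 1 ∨ 3 ≤ m ∧ (if m = 1 then 1 else 0) = 0 := by
    split_ifs <;> omega
  have hm0 : 0 < m := by omega
  refine rn_eq_of_ordering (diam_lwGraph hm (fun h => (hk h).1) hr hc) lwLevel_le ?_ ?_
    (one_lt_card_lwVert he hr hc) (position_mem he hr hc) (position_injective he hr hc)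
    (fun v => lwLevel_of_position_eq_one he hr hc) (fun v => lwLevel_of_position_eq_card he hr hc)
    fun u v => le_dist_add_position_sub he hr hc hk h0
  · intro u v
    split_ifs with h
    · subst h
      exact Nat.add_le_add_right (dist_le_of_fst_eq hm0 (Subsingleton.elim _ _)) 1
    · exact dist_le_add_one hm0 u v
  · intro u v huv
    split_ifs with h
    · subst h
      by_contra! hlt
      exact huv (lwVert_ext (Subsingleton.elim _ _) (by omega) fun i hi => by omega)
    · exact Nat.zero_le _

lemma lbEq_lwGraph (hm : m = 1 ∨ 3 ≤ m) (hr : 0 < r) (hc : ∀ i < r, 2 ≤ c i)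
    (hk : m = 1 → 2 ≤ k 1 ∧ k 1 ∣ c 0) (h0 : m = 1 → 4 ≤ c 0) : lbEq (lwGraph m r k c) := by
  have hk' : m = 1 → 2 ≤ k 1 ∧ k 1 ≤ c 0 := fun h =>
    ⟨(hk h).1, Nat.le_of_dvd (four_pos.trans_le (h0 h)) (hk h).2⟩
  have hd : (diam (lwGraph m r k c) : ℤ) + (if m = 1 then 1 else 0 : ℕ) = 2 * r + 1 := by
    exact_mod_cast diam_lwGraph hm (fun h => (hk h).1) hr hc
  rw [lbEq, rn_lwGraph hm hr hc hk h0, eps_lwGraph hm hk', hd, totalLevel]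
  simp only [level_lwGraph hm hk', Nat.cast_sum]

end LowerBound

lemma sum_Icc_one_eq {M : Type*} [AddCommMonoid M] (f : ℕ → M) (n : ℕ) :
    ∑ i ∈ Finset.Icc 1 n, f i = ∑ i ∈ Finset.range n, f (i + 1) := by
  rw [Finset.range_eq_Ico, Finset.sum_Ico_add', zero_add]
  rfl

lemma levelCard_eq_mul_prod_Icc (m : ℕ) (k q : ℕ → ℕ) (l : ℕ) :
    (levelCard m (fun i => k (i + 1) * q (i + 1)) l : ℤ) =
      m * ∏ j ∈ Finset.Icc 1 l, ((k j : ℤ) * (q j : ℤ)) := by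
  induction l with
  | zero => simp [levelCard]
  | succ l ih =>
    rw [levelCard_succ, Finset.prod_Icc_succ_top (by omega), Nat.cast_mul, ih]
    push_cast
    ring

/-- the level-wise regular block graph `G^m_{(k_1,m_1)⋯(k_r,m_r)}` (here the
parameters `m_i` are called `q i`) is a lower bound block graph and its radio number equals
`[(m-1) + m·Σ_{i=1}^r Π_{j=1}^i k_j m_j](2r+1) - 2m·Σ_{i=1}^r i·Π_{j=1}^i k_j m_j + ε(G)`,
where `ε(G) = 1` if `m = 1` and `ε(G) = 0` if `m ≥ 3`. -/
theorem stmt9 (m r : ℕ) (k q : ℕ → ℕ) (hm : m ≠ 2) (hm0 : 0 < m) (hr : 0 < r)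
    (hk : ∀ i, 1 ≤ i → i ≤ r → 0 < k i)
    (hq : ∀ i, 1 ≤ i → i ≤ r → 2 ≤ q i)
    (hm1 : m = 1 → 2 ≤ k 1) :
    IsLowerBoundBlockGraph (levelwiseRegularBlockGraph m r k q) ∧
    (rn (levelwiseRegularBlockGraph m r k q) : ℤ) =
      (((m : ℤ) - 1) +
          (m : ℤ) * ∑ i ∈ Finset.Icc 1 r, ∏ j ∈ Finset.Icc 1 i, ((k j : ℤ) * (q j : ℤ)))
          * (2 * (r : ℤ) + 1)
        - 2 * (m : ℤ) *
            ∑ i ∈ Finset.Icc 1 r, (i : ℤ) * ∏ j ∈ Finset.Icc 1 i, ((k j : ℤ) * (q j : ℤ))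
        + (if m = 1 then 1 else 0) := by
  have hm' : m = 1 ∨ 3 ≤ m := by omega
  have hk' : m = 1 → 2 ≤ k 1 ∧ k 1 ∣ k (0 + 1) * q (0 + 1) := fun h =>
    ⟨hm1 h, Dvd.intro _ rfl⟩
  have hc : ∀ i < r, 2 ≤ k (i + 1) * q (i + 1) := fun i hi =>
    Nat.mul_le_mul (hk (i + 1) (by omega) hi) (hq (i + 1) (by omega) hi)
  have h0 : m = 1 → 4 ≤ k (0 + 1) * q (0 + 1) := fun h =>
    Nat.mul_le_mul (hm1 h) (hq 1 le_rfl hr)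
  refine ⟨⟨isBlockGraph_lwGraph hm0, lbEq_lwGraph hm' hr hc hk' h0⟩, ?_⟩
  refine (rn_lwGraph hm' hr hc hk' h0).trans ?_
  have hcard : (Fintype.card (LWVert m r fun i => k (i + 1) * q (i + 1)) : ℤ) =
      m + m * ∑ i ∈ Finset.Icc 1 r, ∏ j ∈ Finset.Icc 1 i, ((k j : ℤ) * (q j : ℤ)) := by
    rw [card_lwVert, Finset.sum_range_succ', levelCard_zero, Nat.cast_add, Nat.cast_sum,
      Finset.mul_sum, sum_Icc_one_eq, add_comm]
    simp only [levelCard_eq_mul_prod_Icc]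
  have hsum : ∑ v : LWVert m r fun i => k (i + 1) * q (i + 1), (lwLevel v : ℤ) =
      m * ∑ i ∈ Finset.Icc 1 r, (i : ℤ) * ∏ j ∈ Finset.Icc 1 i, ((k j : ℤ) * (q j : ℤ)) := by
    rw [← Nat.cast_sum, sum_lwLevel fun l => l, Finset.sum_range_succ', mul_zero, add_zero,
      Nat.cast_sum, Finset.mul_sum, sum_Icc_one_eq]
    refine Finset.sum_congr rfl fun i _ => ?_
    rw [Nat.cast_mul, levelCard_eq_mul_prod_Icc]
    ring
  rw [hcard, hsum]
  push_cast
  ring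

end RadioLabeling
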